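/- Let q be an odd prime power with q ≡ 2 (mod 3), let F be a finite field with q elements, let θ ∈ F be a nonsquare, and let μ ∈ F. Then the cubic polynomial z³ − 3μz² + 3θz − μθ ∈ F[z] has either no root in F or exactly three distinct roots in F. -/

import Mathlib

/-- In a finite field of cardinality `≡ 2 (mod 3)`, every cube root of unity is trivial. -/
theorem FiniteField.eq_one_of_pow_three_eq_one {F : Type*} [Field F] [Fintype F]
    (h : Fintype.card F % 3 = 2) {w : F} (hw : w ^ 3 = 1) : w = 1 := by
  have hw0 : w ≠ 0 := by rintro rfl; simp at hw
  have hcard := FiniteField.pow_card_sub_one_eq_one w hw0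
  rwa [show Fintype.card F - 1 = 3 * (Fintype.card F / 3) + 1 by omega, pow_succ, pow_mul, hw,
    one_pow, one_mul] at hcard

theorem FiniteField.two_ne_zero_of_odd_card {F : Type*} [Field F] [Fintype F]
    (h : Odd (Fintype.card F)) : (2 : F) ≠ 0 := by
  intro h2
  obtain ⟨m, hm⟩ := h
  have hcast := FiniteField.cast_card_eq_zero F
  rw [hm] at hcast
  push_cast at hcast
  exact one_ne_zero (by linear_combination hcast - m * h2 : (1 : F) = 0)

theorem FiniteField.three_ne_zero_of_card_mod_three {F : Type*} [Field F] [Fintype F]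
    (h : Fintype.card F % 3 = 2) : (3 : F) ≠ 0 := by
  intro h3
  have hcast := FiniteField.cast_card_eq_zero F
  rw [show Fintype.card F = 3 * (Fintype.card F / 3) + 2 by omega] at hcast
  push_cast at hcast
  exact one_ne_zero
    (by linear_combination h3 - hcast + ((Fintype.card F / 3 : ℕ) : F) * h3 : (1 : F) = 0)

theorem FiniteField.not_isSquare_neg_three {F : Type*} [Field F] [Fintype F]
    (hodd : Odd (Fintype.card F)) (h : Fintype.card F % 3 = 2) : ¬ IsSquare (-3 : F) := by
  rintro ⟨s, hs⟩
  have h2 := FiniteField.two_ne_zero_of_odd_card hodd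
  have h3 := FiniteField.three_ne_zero_of_card_mod_three h
  have hw : ((-1 + s) / 2) ^ 3 = 1 := by
    field_simp
    linear_combination (3 - s) * hs
  have hw1 := FiniteField.eq_one_of_pow_three_eq_one h hw
  have hs3 : s = 3 := by
    field_simp at hw1
    linear_combination hw1
  rw [hs3] at hs
  exact mul_ne_zero (mul_ne_zero h2 h2) h3 (by linear_combination -hs)

theorem FiniteField.isSquare_mul_of_not_isSquare {F : Type*} [Field F] [Fintype F]
    {a b : F} (ha : ¬ IsSquare a) (hb : ¬ IsSquare b) : IsSquare (a * b) := by
  classical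
  have hF : ringChar F ≠ 2 := fun hF ↦ ha (FiniteField.isSquare_of_char_two hF a)
  by_contra hab
  rw [← quadraticChar_neg_one_iff_not_isSquare] at ha hb hab
  rw [map_mul, ha, hb] at hab
  norm_num at hab

/-- If `θ = -3c²` is a nonsquare, a single root of `z³ − 3μz² + 3θz − μθ` yields three distinct
ones, by translation by the `3`-torsion point `c` of the torus `F(√θ)ˣ / Fˣ`. -/
theorem ncard_roots_eq_three {F : Type*} [Field F] {θ μ c z : F} (h2 : (2 : F) ≠ 0)
    (hθ : ¬ ∃ x : F, x ^ 2 = θ) (hc : θ = -3 * c ^ 2)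
    (hz : z ^ 3 - 3 * μ * z ^ 2 + 3 * θ * z - μ * θ = 0) :
    {w : F | w ^ 3 - 3 * μ * w ^ 2 + 3 * θ * w - μ * θ = 0}.ncard = 3 := by
  have hc0 : c ≠ 0 := by
    rintro rfl
    exact hθ ⟨0, by rw [hc]; ring⟩
  have hzc : z ^ 2 - c ^ 2 ≠ 0 := by
    intro h
    have h8 : 2 * 2 * 2 * c ^ 2 * z = 0 := by
      subst hc
      linear_combination -hz + (z - 3 * μ) * h
    have hz0 : z = 0 := by simpa [h2, hc0] using h8
    exact hc0 (by simpa [hz0] using h)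
  have hp : z + c ≠ 0 := fun h ↦ hzc (by linear_combination (z - c) * h)
  have hm : z - c ≠ 0 := fun h ↦ hzc (by linear_combination (z + c) * h)
  have key (w : F) : (w ^ 3 - 3 * μ * w ^ 2 + 3 * θ * w - μ * θ) * (z ^ 2 - c ^ 2) =
      (w - z) * (w * (z + c) - (z * c + θ)) * (w * (z - c) - (θ - z * c)) := by
    subst hc
    linear_combination (w ^ 2 - c ^ 2) * hz
  have hset : {w : F | w ^ 3 - 3 * μ * w ^ 2 + 3 * θ * w - μ * θ = 0} =
      {z, (z * c + θ) / (z + c), (θ - z * c) / (z - c)} := by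
    ext w
    rw [Set.mem_ofPred_eq, ← mul_eq_zero_iff_right hzc]
    simp [key, sub_eq_zero, eq_div_iff hp, eq_div_iff hm, or_assoc]
  rw [hset, Set.ncard_eq_three]
  refine ⟨_, _, _, ?_, ?_, ?_, rfl⟩
  · rw [Ne, eq_div_iff hp]
    exact fun h ↦ hθ ⟨z, by linear_combination h⟩
  · rw [Ne, eq_div_iff hm]
    exact fun h ↦ hθ ⟨z, by linear_combination h⟩
  · rw [Ne, div_eq_div_iff hp hm]
    intro h
    refine hθ ⟨z, mul_left_cancel₀ (mul_ne_zero h2 hc0) ?_⟩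
    linear_combination h

/-- **Statement 19.** Let `q` be an odd prime power with `q ≡ 2 (mod 3)`, `F` a finite field
with `q` elements, `θ ∈ F` a nonsquare and `μ ∈ F`.  Then the cubic
`z³ − 3μz² + 3θz − μθ` has either no root in `F` or exactly three distinct roots in `F`. -/
theorem stmt_19 (q : ℕ) (hq : ∃ p k : ℕ, p.Prime ∧ 0 < k ∧ q = p ^ k) (hodd : Odd q)
    (hq3 : q % 3 = 2) (F : Type) [Field F] [Fintype F] (hF : Fintype.card F = q)
    (θ μ : F) (hθ : ¬ ∃ x : F, x ^ 2 = θ) :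
    {z : F | z ^ 3 - 3 * μ * z ^ 2 + 3 * θ * z - μ * θ = 0} = ∅ ∨
      {z : F | z ^ 3 - 3 * μ * z ^ 2 + 3 * θ * z - μ * θ = 0}.ncard = 3 := by
  subst hF
  have h2 := FiniteField.two_ne_zero_of_odd_card hodd
  have h3 := FiniteField.three_ne_zero_of_card_mod_three hq3
  have hθ' : ¬ IsSquare θ := fun ⟨x, hx⟩ ↦ hθ ⟨x, by rw [hx, sq]⟩
  obtain ⟨s, hs⟩ := FiniteField.isSquare_mul_of_not_isSquare
    (FiniteField.not_isSquare_neg_three hodd hq3) hθ'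
  have hc : θ = -3 * (s / 3) ^ 2 := by
    field_simp
    linear_combination -hs
  refine (Set.eq_empty_or_nonempty _).imp_right ?_
  rintro ⟨z, hz⟩
  exact ncard_roots_eq_three h2 hθ hc hz
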